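/- arXiv:2603.21449 — 4 statements merged into one kernel-verified Lean document; each statement's English description precedes it below -/
import Mathlib

section
/- Let 𝒢 = (G, L) be a primitive labeled graph over a finite alphabet Σ. Then the limit R(X_𝒢) = lim_{n→∞} (1/n)·R(C_n(X_𝒢)) exists and is a rational number. -/
open Filter Set

structure DirGraph (V E : Type) where
  src : E → V
  tgt : E → V

namespace DirGraph

variable {V E : Type}

/-- A (finite) walk: consecutive edges are compatible. -/
def IsWalkList (G : DirGraph V E) (p : List E) : Prop :=
  p.Chain' fun e f => G.tgt e = G.src f

/-- The set of walks of length `n`. -/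
def walks (G : DirGraph V E) (n : ℕ) : Set (List E) :=
  {p | p.length = n ∧ G.IsWalkList p}

/-- The set of walks of length `n` from `v` to `w`. -/
def walksFT (G : DirGraph V E) (n : ℕ) (v w : V) : Set (List E) :=
  {p | p.length = n ∧ G.IsWalkList p ∧
    ∃ h : p ≠ [], G.src (p.head h) = v ∧ G.tgt (p.getLast h) = w}

def IsCycle (G : DirGraph V E) (p : List E) : Prop :=
  G.IsWalkList p ∧ ∃ h : p ≠ [], G.src (p.head h) = G.tgt (p.getLast h)

def Irreducible (G : DirGraph V E) : Prop :=
  ∀ v w : V, ∃ n : ℕ, (G.walksFT n v w).Nonempty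

/-- Irreducible and the gcd of all cycle lengths is 1 (every common divisor of
the cycle lengths equals 1). -/
def Primitive (G : DirGraph V E) : Prop :=
  G.Irreducible ∧ ∀ d : ℕ, (∀ p, G.IsCycle p → d ∣ p.length) → d = 1

end DirGraph

/-- `Σ_i P(q_i, p_i)`. -/
def payoffSum {EG EH : Type} (P : EG → EH → ℤ) (q : List EG) (p : List EH) : ℤ :=
  (List.zipWith P q p).sum

/-- `V_n(G,H,P) = max_{p ∈ W_n(H)} min_{q ∈ W_n(G)} Σ P(q_i,p_i)`. -/
noncomputable def Vn {VG EG VH EH : Type} (G : DirGraph VG EG) (H : DirGraph VH EH)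
    (P : EG → EH → ℤ) (n : ℕ) : ℤ :=
  sSup ((fun p => sInf ((fun q => payoffSum P q p) '' G.walks n)) '' H.walks n)

/-- `M(p)(v,w) = inf {Σ P(q_i,p_i) : q ∈ W_n(G, v → w)}`, with `inf ∅ = ⊤`. -/
noncomputable def Mfun {VG EG EH : Type} (G : DirGraph VG EG) (P : EG → EH → ℤ)
    (p : List EH) : VG → VG → WithTop ℤ :=
  fun v w => sInf ((fun q => ((payoffSum P q p : ℤ) : WithTop ℤ)) '' G.walksFT p.length v w)

/-- `f < g` pointwise everywhere. -/
def StrictDom {V α : Type} [LT α] (f g : V → V → α) : Prop := ∀ v w, f v w < g v w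

/-- `<`-maximal elements of a set w.r.t. a strict domination relation. -/
def maxElems {α : Type} (lt : α → α → Prop) (A : Set α) : Set α :=
  {f ∈ A | ¬ ∃ g ∈ A, lt f g}

/-- Tropical convolution on `(ℤ ∪ {∞})`-valued matrices. -/
noncomputable def tconv {V : Type} (f g : V → V → WithTop ℤ) : V → V → WithTop ℤ :=
  fun u w => sInf (Set.range fun v => f u v + g v w)

/-- Tropical convolution on `ℤ`-valued matrices. -/
noncomputable def tconvZ {V : Type} (f g : V → V → ℤ) : V → V → ℤ :=
  fun u w => sInf (Set.range fun v => f u v + g v w)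

/-- Non-improvable walks in `H` (of any length). -/
noncomputable def walksDagger {VG EG VH EH : Type} (G : DirGraph VG EG) (H : DirGraph VH EH)
    (P : EG → EH → ℤ) : Set (List EH) :=
  {p | ∃ u v : VH, p ∈ H.walksFT p.length u v ∧
    Mfun G P p ∈ maxElems StrictDom (Mfun G P '' H.walksFT p.length u v)}

/-- The edge shift of a graph. -/
def XEdge {V E : Type} (G : DirGraph V E) : Set (ℤ → E) :=
  {x | ∀ n : ℤ, G.tgt (x n) = G.src (x (n + 1))}

/-- The word `x_{[m,n]}` as a list (of length `n - m + 1` when `m ≤ n`). -/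
def seg {A : Type} (x : ℤ → A) (m n : ℤ) : List A :=
  List.ofFn fun i : Fin (n + 1 - m).toNat => x (m + i)

/-- `X_H^†`: points all of whose subwords are non-improvable walks. -/
noncomputable def XHdag {VG EG VH EH : Type} (G : DirGraph VG EG) (H : DirGraph VH EH)
    (P : EG → EH → ℤ) : Set (ℤ → EH) :=
  {x | x ∈ XEdge H ∧ ∀ m n : ℤ, m ≤ n → seg x m n ∈ walksDagger G H P}

/-- `R(p)`: optimal responses to `p`. -/
noncomputable def Rset {VG EG EH : Type} (G : DirGraph VG EG) (P : EG → EH → ℤ)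
    (p : List EH) : Set (List EG) :=
  {q | ∃ v w : VG, q ∈ G.walksFT p.length v w ∧
    ((payoffSum P q p : ℤ) : WithTop ℤ) = Mfun G P p v w}

/-- `X_𝒢`: the sofic shift presented by the labeled graph `(G, L)`. -/
def XGset {V E A : Type} (G : DirGraph V E) (L : E → A) : Set (ℤ → A) :=
  {x | ∀ m n : ℤ, m ≤ n → ∃ p ∈ G.walks (n + 1 - m).toNat, p.map L = seg x m n}

/-- `C_n(S) = {x_{[1,n]} : x ∈ S}`. -/
def wordsOf {A : Type} (S : Set (ℤ → A)) (n : ℕ) : Set (Fin n → A) :=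
  {w | ∃ x ∈ S, ∀ i : Fin n, w i = x (1 + (i : ℤ))}

/-- The covering radius of a code `C ⊆ Σ^n`:
`R(C) = max_{v ∈ Σ^n} min_{w ∈ C} d_H(v, w)`. -/
noncomputable def coveringRadius {A : Type} [Fintype A] [DecidableEq A] {n : ℕ}
    (C : Set (Fin n → A)) : ℕ :=
  ⨆ v : Fin n → A, ⨅ w : C, hammingDist v (w : Fin n → A)

/-- A length-bounded cost on words that is compatible with a right congruence of finite index
has a rational asymptotic worst-case growth rate. -/
theorem exists_rat_tendsto_of_finite_key {A K : Type} [Nonempty A] [Fintype K]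
    (f : List A → ℕ) (key : List A → K) (F : ℕ → ℕ)
    (hnil : f [] = 0) (hmono : ∀ a u, f u ≤ f (a :: u)) (hlip : ∀ a u, f (a :: u) ≤ f u + 1)
    (hkey : ∀ a u u', key u = key u' →
      key (a :: u) = key (a :: u') ∧ f (a :: u) + f u' = f (a :: u') + f u)
    (hF : ∀ u, u ≠ [] → f u ≤ F u.length)
    (hF' : ∀ n, n ≠ 0 → ∃ u : List A, u.length = n ∧ f u = F n) :
    ∃ R : ℚ, Tendsto (fun n : ℕ => (F n : ℝ) / n) atTop (nhds (R : ℝ)) := by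
  have hmono' : ∀ v u, f u ≤ f (v ++ u) := by
    intro v u
    induction v with
    | nil => simp
    | cons a v ih => exact ih.trans (hmono a _)
  have hlip' : ∀ v u, f (v ++ u) ≤ f u + v.length := by
    intro v u
    induction v with
    | nil => simp
    | cons a v ih =>
      have := hlip a (v ++ u)
      simp only [List.cons_append, List.length_cons]
      omega
  have hkey' : ∀ v u u', key u = key u' →
      key (v ++ u) = key (v ++ u') ∧ f (v ++ u) + f u' = f (v ++ u') + f u := by
    intro v u u' h
    induction v with
    | nil => exact ⟨h, Nat.add_comm _ _⟩
    | cons a v ih =>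
      obtain ⟨h1, h2⟩ := hkey a _ _ ih.1
      simp only [List.cons_append]
      exact ⟨h1, by omega⟩
  set S := Fintype.card K
  have pigeon : ∀ w : List A, S ≤ w.length → ∃ r v u : List A, w = r ++ (v ++ u) ∧
      v ≠ [] ∧ v.length ≤ S ∧ key (v ++ u) = key u := by
    intro w hw
    obtain ⟨i, j, hij, h⟩ : ∃ i j : Fin (S + 1), i < j ∧
        key (w.drop (w.length - i)) = key (w.drop (w.length - j)) := by
      obtain ⟨i, j, hij, h⟩ := Fintype.exists_ne_map_eq_of_card_lt
        (fun i : Fin (S + 1) => key (w.drop (w.length - i))) (by simp [S])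
      rcases lt_or_gt_of_ne hij with hlt | hlt
      exacts [⟨i, j, hlt, h⟩, ⟨j, i, hlt, h.symm⟩]
    have hi := i.2
    have hj := j.2
    have hij' : (i : ℕ) < j := hij
    have hsplit : (w.drop (w.length - j)).take (j - i) ++ w.drop (w.length - i) =
        w.drop (w.length - j) := by
      conv_rhs => rw [← List.take_append_drop (j - i) (w.drop (w.length - j)), List.drop_drop]
      congr 2
      omega
    refine ⟨w.take (w.length - j), (w.drop (w.length - j)).take (j - i),
      w.drop (w.length - i), ?_, ?_, ?_, ?_⟩
    · rw [hsplit, List.take_append_drop]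
    · rw [← List.length_pos_iff]
      simp only [List.length_take, List.length_drop]
      omega
    · simp only [List.length_take, List.length_drop]
      omega
    · rw [hsplit, h]
  let C : Set (List A × List A) := {p | p.1 ≠ [] ∧ p.1.length ≤ S ∧ key (p.1 ++ p.2) = key p.2}
  let m : List A × List A → ℚ := fun p => ((f (p.1 ++ p.2) - f p.2 : ℕ) : ℚ) / p.1.length
  have hfin : (m '' C).Finite := by
    refine Set.Finite.subset (((Finset.range (S + 1)) ×ˢ (Finset.range (S + 1))).image
      (fun q : ℕ × ℕ => (q.1 : ℚ) / q.2)).finite_toSet ?_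
    rintro _ ⟨p, hp, rfl⟩
    have := hlip' p.1 p.2
    have hp2 := hp.2.1
    simp only [Finset.coe_image, Set.mem_image, Finset.mem_coe, Finset.mem_product,
      Finset.mem_range]
    exact ⟨(f (p.1 ++ p.2) - f p.2, p.1.length), by constructor <;> dsimp only <;> omega, rfl⟩
  have hne : (m '' C).Nonempty := by
    obtain ⟨r, v, u, -, h1, h2, h3⟩ :=
      pigeon (List.replicate S (Classical.arbitrary A)) (by simp)
    exact ⟨_, (v, u), ⟨h1, h2, h3⟩, rfl⟩
  obtain ⟨R, ⟨⟨v, u⟩, ⟨hv, -, hvu⟩, hR⟩, hmax⟩ := Set.exists_max_image _ id hfin hne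
  simp only [id] at hmax
  have hupper : ∀ n, ∀ w : List A, w.length = n → (f w : ℚ) ≤ R * w.length + S := by
    have hR0 : 0 ≤ R := by rw [← hR]; positivity
    intro n
    induction n using Nat.strong_induction_on with
    | _ n ih =>
      intro w hw
      by_cases hS : S ≤ w.length
      · obtain ⟨r, y, x, rfl, h1, h2, h3⟩ := pigeon w hS
        have hy : 0 < y.length := List.length_pos_iff.mpr h1
        have hle := ih (r ++ x).length (by rw [← hw]; simp only [List.length_append]; omega)
          _ rfl
        have hm : m (y, x) ≤ R := hmax _ ⟨(y, x), ⟨h1, h2, h3⟩, rfl⟩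
        have hm' : ((f (y ++ x) - f x : ℕ) : ℚ) ≤ R * y.length := by
          rwa [div_le_iff₀ (by exact_mod_cast hy)] at hm
        rw [Nat.cast_sub (hmono' y x)] at hm'
        have h4 : (f (r ++ (y ++ x)) : ℚ) + f x = f (r ++ x) + f (y ++ x) := by
          exact_mod_cast (hkey' r _ _ h3).2
        simp only [List.length_append, Nat.cast_add] at hle ⊢
        linarith
      · have h1 := hlip' w []
        rw [List.append_nil, hnil] at h1
        have h2 : (f w : ℚ) ≤ S := by exact_mod_cast (by omega : f w ≤ S)
        have : 0 ≤ R * w.length := by positivity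
        linarith
  have hv0 : 0 < v.length := List.length_pos_iff.mpr hv
  have hRv : (f (v ++ u) : ℚ) = f u + R * v.length := by
    rw [← hR]
    simp only [m]
    rw [Nat.cast_sub (hmono' v u)]
    field_simp
    ring
  have hiter : ∀ k : ℕ, ∃ w : List A, w.length = k * v.length + u.length ∧ key w = key u ∧
      R * (k * v.length) ≤ f w := by
    intro k
    induction k with
    | zero => exact ⟨u, by simp, rfl, by simp⟩
    | succ k ih =>
      obtain ⟨w, h1, h2, h3⟩ := ih
      obtain ⟨h4, h5⟩ := hkey' v _ _ h2
      refine ⟨v ++ w, by rw [List.length_append, h1]; ring, h4.trans hvu, ?_⟩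
      have h5' : (f (v ++ w) : ℚ) + f u = f (v ++ u) + f w := by exact_mod_cast h5
      push_cast
      linarith
  have hR1 : R ≤ 1 := by
    have : (f (v ++ u) : ℚ) ≤ f u + v.length := by exact_mod_cast hlip' v u
    rw [hRv] at this
    have hv0' : (0 : ℚ) < v.length := by exact_mod_cast hv0
    nlinarith
  have hR0 : 0 ≤ R := by rw [← hR]; positivity
  have hlower : ∀ n : ℕ, n ≠ 0 → R * n - (u.length + v.length) ≤ F n := by
    intro n hn
    by_cases hnu : n < u.length
    · have : (n : ℚ) ≤ u.length := by exact_mod_cast hnu.le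
      have h2 : R * n ≤ n := mul_le_of_le_one_left (by positivity) hR1
      have h3 : (0 : ℚ) ≤ F n := by positivity
      have h4 : (0 : ℚ) ≤ v.length := by positivity
      linarith
    · push Not at hnu
      obtain ⟨w, h1, -, h3⟩ := hiter ((n - u.length) / v.length)
      have hdiv := Nat.div_add_mod (n - u.length) v.length
      have hmod := Nat.mod_lt (n - u.length) hv0
      rw [mul_comm] at hdiv
      set k := (n - u.length) / v.length
      have hlen : (List.replicate (n - w.length) (Classical.arbitrary A) ++ w).length = n := by
        simp only [List.length_append, List.length_replicate]
        omega
      have h4 := hF (List.replicate (n - w.length) (Classical.arbitrary A) ++ w)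
        (by intro h; rw [h] at hlen; exact hn hlen.symm)
      rw [hlen] at h4
      have h5 : (f w : ℚ) ≤ F n := by exact_mod_cast (hmono' _ _).trans h4
      have h6 : (n : ℚ) ≤ k * v.length + v.length + u.length := by
        exact_mod_cast (by omega : n ≤ k * v.length + v.length + u.length)
      have h7 : R * n ≤ R * (k * v.length) + R * (v.length + u.length) := by
        rw [← mul_add]
        exact mul_le_mul_of_nonneg_left (by linarith) hR0
      have h8 : R * (v.length + u.length : ℚ) ≤ v.length + u.length :=
        mul_le_of_le_one_left (by positivity) hR1
      linarith
  refine ⟨R, ?_⟩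
  have hlim : ∀ c : ℝ, Tendsto (fun n : ℕ => (R : ℝ) + c / n) atTop (nhds (R : ℝ)) := by
    intro c
    simpa using (tendsto_const_div_atTop_nhds_zero_nat c).const_add (R : ℝ)
  refine tendsto_of_tendsto_of_tendsto_of_le_of_le' (hlim (-(u.length + v.length))) (hlim S)
    ?_ ?_
  · filter_upwards [eventually_gt_atTop 0] with n hn
    have hn' : (0 : ℝ) < n := by exact_mod_cast hn
    have := hlower n hn.ne'
    have h : (R : ℝ) * n - (u.length + v.length) ≤ F n := by exact_mod_cast this
    rw [le_div_iff₀ hn', add_mul, div_mul_cancel₀ _ hn'.ne']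
    linarith
  · filter_upwards [eventually_gt_atTop 0] with n hn
    have hn' : (0 : ℝ) < n := by exact_mod_cast hn
    obtain ⟨w, h1, h2⟩ := hF' n hn.ne'
    have := hupper n w h1
    rw [h1, h2] at this
    have h : (F n : ℝ) ≤ R * n + S := by exact_mod_cast this
    rw [div_le_iff₀ hn', add_mul, div_mul_cancel₀ _ hn'.ne']
    linarith

namespace DirGraph

variable {V E : Type}

/-- `w` can be reached from `v` by a walk of length `n`. -/
def Reach (G : DirGraph V E) : ℕ → V → V → Prop
  | 0, v, w => v = w
  | n + 1, v, w => ∃ e, G.tgt e = w ∧ G.Reach n v (G.src e)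

theorem Reach.trans {G : DirGraph V E} {m n : ℕ} {u v w : V} (h : G.Reach m u v)
    (h' : G.Reach n v w) : G.Reach (m + n) u w := by
  induction n generalizing w with
  | zero => exact h' ▸ h
  | succ n ih =>
    obtain ⟨e, he, h'⟩ := h'
    exact ⟨e, he, ih h'⟩

theorem IsWalkList.reach {G : DirGraph V E} {p : List E} (hp : G.IsWalkList p) (h : p ≠ []) :
    G.Reach p.length (G.src (p.head h)) (G.tgt (p.getLast h)) := by
  induction p with
  | nil => exact absurd rfl h
  | cons e p ih =>
    cases p with
    | nil => exact ⟨e, rfl, rfl⟩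
    | cons f p =>
      have hp' : G.tgt e = G.src f ∧ List.IsChain (fun e f => G.tgt e = G.src f) (f :: p) :=
        List.isChain_cons_cons.mp hp
      have h1 := ih hp'.2 (by simp)
      have h0 : G.Reach 1 (G.src e) (G.src f) := ⟨e, hp'.1, rfl⟩
      have h2 := h0.trans h1
      rw [Nat.add_comm] at h2
      simpa using h2

theorem Primitive.nonempty {G : DirGraph V E} (hG : G.Primitive) : Nonempty V := by
  by_contra h
  have : (0 : ℕ) = 1 := hG.2 0 fun p ⟨_, hp, _⟩ => (h ⟨G.src (p.head hp)⟩).elim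
  omega

theorem Irreducible.exists_reach {G : DirGraph V E} (hG : G.Irreducible) (v w : V) :
    ∃ n, G.Reach (n + 1) v w := by
  obtain ⟨n, p, hlen, hp, hne, rfl, rfl⟩ := hG v w
  refine ⟨p.length - 1, ?_⟩
  rw [Nat.sub_add_cancel (List.length_pos_iff.mpr hne)]
  exact hp.reach hne

theorem Irreducible.exists_tgt {G : DirGraph V E} (hG : G.Irreducible) (v : V) :
    ∃ e, G.tgt e = v := by
  obtain ⟨n, e, he, -⟩ := hG.exists_reach v v
  exact ⟨e, he⟩

theorem Irreducible.exists_src {G : DirGraph V E} (hG : G.Irreducible) (v : V) :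
    ∃ e, G.src e = v := by
  obtain ⟨n, p, hlen, hp, hne, h1, -⟩ := hG v v
  exact ⟨_, h1⟩

/-- In a primitive graph, all pairs of vertices are joined by walks of one common length. -/
theorem Primitive.exists_forall_reach [Fintype V] {G : DirGraph V E} (hG : G.Primitive) :
    ∃ N, ∀ v w, G.Reach N v w := by
  obtain ⟨v₀⟩ := hG.nonempty
  let M : AddSubmonoid ℕ :=
    { carrier := {n | G.Reach n v₀ v₀}
      zero_mem' := rfl
      add_mem' := fun h h' => Reach.trans h h' }
  have hgcd : Nat.setGcd (M : Set ℕ) = 1 := by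
    refine hG.2 _ fun p ⟨hp, hne, hcyc⟩ => ?_
    obtain ⟨a, ha⟩ := hG.1.exists_reach v₀ (G.src (p.head hne))
    obtain ⟨b, hb⟩ := hG.1.exists_reach (G.src (p.head hne)) v₀
    have h := hp.reach hne
    rw [← hcyc] at h
    have h1 : Nat.setGcd (M : Set ℕ) ∣ (a + 1) + (b + 1) :=
      Nat.setGcd_dvd_of_mem (ha.trans hb)
    have h2 : Nat.setGcd (M : Set ℕ) ∣ ((a + 1) + p.length) + (b + 1) :=
      Nat.setGcd_dvd_of_mem ((ha.trans h).trans hb)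
    have h3 : ((a + 1) + p.length) + (b + 1) = ((a + 1) + (b + 1)) + p.length := by ring
    rw [h3] at h2
    exact (Nat.dvd_add_right h1).mp h2
  obtain ⟨n, hn⟩ := Nat.exists_mem_closure_of_ge (M : Set ℕ)
  rw [AddSubmonoid.closure_eq, hgcd] at hn
  choose a ha using fun v => hG.1.exists_reach v v₀
  choose b hb using fun w => hG.1.exists_reach v₀ w
  refine ⟨n + ∑ v, (a v + 1) + ∑ w, (b w + 1), fun v w => ?_⟩
  have h1 : a v + 1 ≤ ∑ v, (a v + 1) :=
    Finset.single_le_sum (f := fun v => a v + 1) (fun _ _ => Nat.zero_le _) (Finset.mem_univ v)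
  have h2 : b w + 1 ≤ ∑ w, (b w + 1) :=
    Finset.single_le_sum (f := fun w => b w + 1) (fun _ _ => Nat.zero_le _) (Finset.mem_univ w)
  obtain ⟨c, hc⟩ := Nat.exists_eq_add_of_le h1
  obtain ⟨d, hd⟩ := Nat.exists_eq_add_of_le h2
  have h3 : G.Reach (n + c + d) v₀ v₀ := hn _ (by omega) (one_dvd _)
  have h4 := ((ha v).trans h3).trans (hb w)
  convert h4 using 1
  omega

/-- The least number of mismatches between the word `u`, read backwards, and the labels of a
walk of length `u.length` ending at `w`. -/
noncomputable def mismatch {A : Type} [DecidableEq A] (G : DirGraph V E) (L : E → A) :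
    List A → V → ℕ
  | [], _ => 0
  | a :: u, w => ⨅ e : {e // G.tgt e = w}, (G.mismatch L u (G.src e) + if a = L e then 0 else 1)

section mismatch

variable {A : Type} [DecidableEq A] {G : DirGraph V E} (L : E → A)

theorem mismatch_cons_le (a : A) (u : List A) (e : E) :
    G.mismatch L (a :: u) (G.tgt e) ≤ G.mismatch L u (G.src e) + if a = L e then 0 else 1 :=
  ciInf_le (f := fun e' : {e' // G.tgt e' = G.tgt e} =>
    G.mismatch L u (G.src e') + if a = L e' then 0 else 1) (OrderBot.bddBelow _) ⟨e, rfl⟩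

theorem exists_mismatch_cons (hG : G.Irreducible) (a : A) (u : List A) (w : V) :
    ∃ e, G.tgt e = w ∧
      G.mismatch L (a :: u) w = G.mismatch L u (G.src e) + if a = L e then 0 else 1 := by
  have : Nonempty {e // G.tgt e = w} := by
    obtain ⟨e, he⟩ := hG.exists_tgt w
    exact ⟨e, he⟩
  obtain ⟨⟨e, he⟩, h⟩ := Nat.sInf_mem (Set.range_nonempty (fun e : {e // G.tgt e = w} =>
    G.mismatch L u (G.src e) + if a = L e then 0 else 1))
  exact ⟨e, he, h.symm⟩

theorem mismatch_append_le (v u : List A) {s w : V} (h : G.Reach v.length s w) :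
    G.mismatch L (v ++ u) w ≤ G.mismatch L u s + v.length := by
  induction v generalizing w with
  | nil => obtain rfl : s = w := h; simp
  | cons a v ih =>
    obtain ⟨e, rfl, h⟩ := h
    have h1 := ih h
    have h2 := mismatch_cons_le (G := G) L a (v ++ u) e
    have h3 : (if a = L e then 0 else 1) ≤ 1 := by split_ifs <;> omega
    simp only [List.cons_append, List.length_cons]
    omega

theorem mismatch_le_length (hG : G.Irreducible) (u : List A) (w : V) :
    G.mismatch L u w ≤ u.length := by
  induction u generalizing w with
  | nil => simp [mismatch]
  | cons a u ih =>
    obtain ⟨e, rfl⟩ := hG.exists_tgt w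
    have h1 := ih (G.src e)
    have h2 := mismatch_cons_le (G := G) L a u e
    have h3 : (if a = L e then 0 else 1) ≤ 1 := by split_ifs <;> omega
    simp only [List.length_cons]
    omega

/-- The least number of mismatches between `u`, read backwards, and the labels of a walk. -/
noncomputable def minMismatch (G : DirGraph V E) (L : E → A) (u : List A) : ℕ :=
  ⨅ w, G.mismatch L u w

theorem minMismatch_le (u : List A) (w : V) : G.minMismatch L u ≤ G.mismatch L u w :=
  ciInf_le (OrderBot.bddBelow _) w

theorem exists_minMismatch [Nonempty V] (u : List A) :
    ∃ w, G.minMismatch L u = G.mismatch L u w := by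
  obtain ⟨w, h⟩ := Nat.sInf_mem (Set.range_nonempty (G.mismatch L u))
  exact ⟨w, h.symm⟩

theorem minMismatch_le_cons [Nonempty V] (hG : G.Irreducible) (a : A) (u : List A) :
    G.minMismatch L u ≤ G.minMismatch L (a :: u) := by
  obtain ⟨w, hw⟩ := exists_minMismatch (G := G) L (a :: u)
  obtain ⟨e, -, he⟩ := exists_mismatch_cons L hG a u w
  have := minMismatch_le (G := G) L u (G.src e)
  omega

theorem minMismatch_cons_le [Nonempty V] (hG : G.Irreducible) (a : A) (u : List A) :
    G.minMismatch L (a :: u) ≤ G.minMismatch L u + 1 := by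
  obtain ⟨w, hw⟩ := exists_minMismatch (G := G) L u
  obtain ⟨e, rfl⟩ := hG.exists_src w
  have h1 := mismatch_cons_le (G := G) L a u e
  have h2 := minMismatch_le (G := G) L (a :: u) (G.tgt e)
  have h3 : (if a = L e then 0 else 1) ≤ 1 := by split_ifs <;> omega
  omega

theorem minMismatch_le_append [Nonempty V] (hG : G.Irreducible) (v u : List A) :
    G.minMismatch L u ≤ G.minMismatch L (v ++ u) := by
  induction v with
  | nil => simp
  | cons a v ih => exact ih.trans (minMismatch_le_cons L hG a _)

theorem mismatch_le_minMismatch_add [Nonempty V] (hG : G.Irreducible) {N : ℕ}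
    (hN : ∀ v w, G.Reach N v w) (u : List A) (w : V) :
    G.mismatch L u w ≤ G.minMismatch L u + N := by
  rcases le_or_gt u.length N with h | h
  · exact ((mismatch_le_length L hG u w).trans h).trans (Nat.le_add_left _ _)
  · have hlen : (u.take N).length = N := by rw [List.length_take]; omega
    obtain ⟨s, hs⟩ := exists_minMismatch (G := G) L (u.drop N)
    have h1 := mismatch_append_le (G := G) L (u.take N) (u.drop N) (s := s) (w := w)
      (by rw [hlen]; exact hN s w)
    have h2 := minMismatch_le_append L hG (u.take N) (u.drop N)
    rw [List.take_append_drop] at h1 h2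
    omega

theorem mismatch_cons_add_le (hG : G.Irreducible) {u u' : List A} {c d : ℕ}
    (h : ∀ w, G.mismatch L u w + c = G.mismatch L u' w + d) (a : A) (w : V) :
    G.mismatch L (a :: u) w + c ≤ G.mismatch L (a :: u') w + d := by
  obtain ⟨e, rfl, he⟩ := exists_mismatch_cons L hG a u' w
  have h1 := mismatch_cons_le (G := G) L a u e
  have h2 := h (G.src e)
  omega

theorem minMismatch_add_le [Nonempty V] {u u' : List A} {c d : ℕ}
    (h : ∀ w, G.mismatch L u w + c = G.mismatch L u' w + d) :
    G.minMismatch L u + c ≤ G.minMismatch L u' + d := by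
  obtain ⟨w, hw⟩ := exists_minMismatch (G := G) L u'
  have h1 := minMismatch_le (G := G) L u w
  have h2 := h w
  omega

/-- A left-infinite walk realizing `mismatch`. -/
theorem exists_left_infinite_walk (hG : G.Irreducible) (u : List A) (w : V) :
    ∃ z : ℕ → E, G.tgt (z 0) = w ∧ (∀ k, G.tgt (z (k + 1)) = G.src (z k)) ∧
      ∑ k : Fin u.length, (if u[k] = L (z k) then 0 else 1) = G.mismatch L u w := by
  induction u generalizing w with
  | nil =>
    choose inn hinn using hG.exists_tgt
    refine ⟨fun k => Nat.rec (inn w) (fun _ e => inn (G.src e)) k, hinn w, fun k => hinn _, ?_⟩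
    simp [mismatch]
  | cons a u ih =>
    obtain ⟨e, he, hmin⟩ := exists_mismatch_cons L hG a u w
    obtain ⟨z, h1, h2, h3⟩ := ih (G.src e)
    refine ⟨fun k => Nat.casesOn k e z, he, ?_, ?_⟩
    · rintro (_ | k)
      exacts [h1, h2 k]
    · rw [hmin, ← h3, add_comm]
      exact Fin.sum_univ_succ _

theorem mismatch_le_sum (u : List A) (z : ℕ → E)
    (hz : ∀ k, k + 1 < u.length → G.tgt (z (k + 1)) = G.src (z k)) :
    G.mismatch L u (G.tgt (z 0)) ≤
      ∑ k : Fin u.length, (if u[k] = L (z k) then 0 else 1) := by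
  induction u generalizing z with
  | nil => simp [mismatch]
  | cons a u ih =>
    have h1 := ih (fun k => z (k + 1)) (fun k hk => hz (k + 1) (by simpa using hk))
    have h2 : ∑ k : Fin (a :: u).length, (if (a :: u)[k] = L (z k) then 0 else 1) =
        (if a = L (z 0) then 0 else 1) +
          ∑ k : Fin u.length, (if u[k] = L (z (k + 1)) then 0 else 1) := Fin.sum_univ_succ _
    have h3 := mismatch_cons_le (G := G) L a u (z 0)
    rw [h2]
    cases u with
    | nil => simpa [mismatch] using h3
    | cons b u =>
      have h4 := hz 0 (by simp)
      rw [zero_add] at h4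
      simp only [zero_add, h4] at h1
      omega

end mismatch

end DirGraph

theorem XEdge.label_mem_XGset {V E A : Type} {G : DirGraph V E} (L : E → A) {y : ℤ → E}
    (hy : y ∈ XEdge G) : (fun i => L (y i)) ∈ XGset G L := by
  intro m n _
  refine ⟨seg y m n, ⟨by simp [seg], ?_⟩, by simp [seg, List.map_ofFn, Function.comp_def]⟩
  refine List.isChain_iff_getElem.mpr fun i hi => ?_
  simp only [seg, List.getElem_ofFn, hy (m + (i : ℤ))]
  push_cast
  rw [add_assoc]

namespace DirGraph

variable {V E A : Type} [DecidableEq A] {G : DirGraph V E} (L : E → A)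

theorem sum_ofFn_rev_eq_hammingDist {n : ℕ} (v w : Fin n → A) (z : ℕ → E)
    (h : ∀ k : Fin n, w k.rev = L (z k)) :
    ∑ k : Fin (List.ofFn (v ∘ Fin.rev)).length,
      (if (List.ofFn (v ∘ Fin.rev))[k] = L (z k) then 0 else 1) = hammingDist v w := by
  rw [hammingDist, Finset.card_filter]
  refine Fintype.sum_equiv ((finCongr List.length_ofFn).trans Fin.revPerm) _ _ fun k => ?_
  have hk := h (finCongr List.length_ofFn k)
  simp only [Equiv.trans_apply, Fin.revPerm_apply, hk, ite_not, ne_eq, Fin.getElem_fin,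
    List.getElem_ofFn]
  rfl

theorem iInf_hammingDist_eq_minMismatch [Nonempty V] (hG : G.Irreducible) {n : ℕ} (hn : n ≠ 0)
    (v : Fin n → A) :
    ⨅ w : wordsOf (XGset G L) n, hammingDist v (w : Fin n → A) =
      G.minMismatch L (List.ofFn (v ∘ Fin.rev)) := by
  have hattain : ∃ w : wordsOf (XGset G L) n,
      hammingDist v (w : Fin n → A) = G.minMismatch L (List.ofFn (v ∘ Fin.rev)) := by
    obtain ⟨s, hs⟩ := exists_minMismatch (G := G) L (List.ofFn (v ∘ Fin.rev))
    obtain ⟨z, hz0, hz, hsum⟩ := exists_left_infinite_walk L hG (List.ofFn (v ∘ Fin.rev)) s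
    choose out hout using hG.exists_src
    let r : ℕ → E := fun k => Nat.rec (out s) (fun _ e => out (G.tgt e)) k
    let y : ℤ → E := fun i => if i ≤ n then z (n - i).toNat else r (i - n - 1).toNat
    have hy : y ∈ XEdge G := by
      intro i
      rcases lt_trichotomy i n with h | h | h
      · have h1 : ((n : ℤ) - i).toNat = ((n : ℤ) - (i + 1)).toNat + 1 := by omega
        simp only [y, if_pos h.le, if_pos (show i + 1 ≤ (n : ℤ) by omega), h1, hz]
      · subst h
        simp [y, r, hz0, hout]
      · have h1 : (i + 1 - (n : ℤ) - 1).toNat = (i - (n : ℤ) - 1).toNat + 1 := by omega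
        simp only [y, if_neg (show ¬ i ≤ (n : ℤ) by omega),
          if_neg (show ¬ i + 1 ≤ (n : ℤ) by omega), h1]
        exact (hout _).symm
    refine ⟨⟨fun i => L (y (1 + (i : ℤ))), _, XEdge.label_mem_XGset L hy, fun i => rfl⟩, ?_⟩
    rw [hs, ← hsum]
    refine (sum_ofFn_rev_eq_hammingDist L v _ z fun k => ?_).symm
    have hk := k.2
    have h1 : 1 + ((k.rev : ℕ) : ℤ) ≤ n := by rw [Fin.val_rev]; omega
    have h2 : ((n : ℤ) - (1 + ((k.rev : ℕ) : ℤ))).toNat = k := by rw [Fin.val_rev]; omega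
    simp only [y, if_pos h1, h2]
  obtain ⟨w₀, hw₀⟩ := hattain
  have : Nonempty (wordsOf (XGset G L) n) := ⟨w₀⟩
  refine le_antisymm (hw₀ ▸ ciInf_le (OrderBot.bddBelow _) w₀) (le_ciInf ?_)
  rintro ⟨w, x, hx, hw⟩
  obtain ⟨p, ⟨hlen, hp⟩, hpL⟩ := hx 1 n (by omega)
  have hlen' : p.length = n := by rw [hlen]; omega
  let z : ℕ → E := fun k => p[n - 1 - k]'(by omega)
  have hsum := sum_ofFn_rev_eq_hammingDist L v w z fun k => by
    have hk := k.2
    have h1 : (p.map L)[n - 1 - (k : ℕ)]'(by rw [List.length_map]; omega) =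
        x (1 + ((n - 1 - (k : ℕ) : ℕ) : ℤ)) := by
      simp only [hpL, seg, List.getElem_ofFn]
    rw [List.getElem_map] at h1
    rw [hw, Fin.val_rev]
    simp only [z, h1]
    congr 2
    omega
  rw [← hsum]
  refine (minMismatch_le L _ _).trans (mismatch_le_sum L _ z fun k hk => ?_)
  rw [List.length_ofFn] at hk
  have h1 := List.isChain_iff_getElem.mp hp (n - 1 - (k + 1)) (by omega)
  simp only [z]
  have h2 : n - 1 - (k + 1) + 1 = n - 1 - k := by omega
  simp only [h2] at h1
  exact h1

end DirGraph

/-- The covering radius of a primitive sofic shift exists as a limit of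
`R(C_n(X_𝒢))/n` and is a rational number. -/
theorem covering_radius_rational {V E A : Type} [Fintype V] [Fintype E] [Fintype A]
    [DecidableEq A] (G : DirGraph V E) (L : E → A) (hG : G.Primitive) :
    ∃ R : ℚ, Filter.Tendsto
      (fun n : ℕ => (coveringRadius (wordsOf (XGset G L) n) : ℝ) / n)
      Filter.atTop (nhds (R : ℝ)) := by
  classical
  obtain ⟨N, hN⟩ := hG.exists_forall_reach
  have hV := hG.nonempty
  have hA : Nonempty A := by
    obtain ⟨e, -⟩ := hG.1.exists_tgt hV.some
    exact ⟨L e⟩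
  have hosc := fun u w => DirGraph.mismatch_le_minMismatch_add L hG.1 hN u w
  have hle := fun u w => DirGraph.minMismatch_le (G := G) L u w
  have hcov : ∀ n, n ≠ 0 → coveringRadius (wordsOf (XGset G L) n) =
      ⨆ v : Fin n → A, G.minMismatch L (List.ofFn (v ∘ Fin.rev)) := fun n hn => by
    simp only [coveringRadius, DirGraph.iInf_hammingDist_eq_minMismatch L hG.1 hn]
  refine exists_rat_tendsto_of_finite_key (K := V → Fin (N + 1)) (G.minMismatch L)
    (fun u w => ⟨G.mismatch L u w - G.minMismatch L u, by have := hosc u w; omega⟩) _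
    ?_ (DirGraph.minMismatch_le_cons L hG.1) (DirGraph.minMismatch_cons_le L hG.1) ?_ ?_ ?_
  · obtain ⟨w, hw⟩ := DirGraph.exists_minMismatch (G := G) L []
    exact hw
  · intro a u u' h
    have h1 : ∀ w, G.mismatch L u w + G.minMismatch L u' =
        G.mismatch L u' w + G.minMismatch L u := fun w => by
      have h2 := congrArg Fin.val (congrFun h w)
      have h3 := hle u w
      have h4 := hle u' w
      dsimp only at h2
      omega
    have h2 : ∀ w, G.mismatch L (a :: u) w + G.minMismatch L u' =
        G.mismatch L (a :: u') w + G.minMismatch L u := fun w =>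
      le_antisymm (DirGraph.mismatch_cons_add_le L hG.1 h1 a w)
        (DirGraph.mismatch_cons_add_le L hG.1 (fun w => (h1 w).symm) a w)
    have h3 : G.minMismatch L (a :: u) + G.minMismatch L u' =
        G.minMismatch L (a :: u') + G.minMismatch L u :=
      le_antisymm (DirGraph.minMismatch_add_le L h2)
        (DirGraph.minMismatch_add_le L fun w => (h2 w).symm)
    refine ⟨funext fun w => Fin.ext ?_, h3⟩
    have h4 := h2 w
    have h5 := hle (a :: u) w
    have h6 := hle (a :: u') w
    dsimp only
    omega
  · intro u hu
    rw [hcov _ (List.length_pos_iff.mpr hu).ne']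
    have h1 : List.ofFn ((u.get ∘ Fin.rev) ∘ Fin.rev) = u := by
      simp only [Function.comp_assoc, Fin.rev_involutive.comp_self, Function.comp_id,
        List.ofFn_get]
    conv_lhs => rw [← h1]
    exact le_ciSup (f := fun v : Fin u.length → A =>
      G.minMismatch L (List.ofFn (v ∘ Fin.rev))) (Set.finite_range _).bddAbove _
  · intro n hn
    rw [hcov n hn]
    obtain ⟨v, hv⟩ := exists_eq_ciSup_of_finite
      (f := fun v : Fin n → A => G.minMismatch L (List.ofFn (v ∘ Fin.rev)))
    exact ⟨_, List.length_ofFn, hv⟩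
end

section
/- Let E be a finite set and let A, B ⊆ (ℤ ∪ {+∞})^{E × E} be finite sets. If f ∈ A and g ∈ B are such that f*g is <-maximal in A*B and f*g is ℤ-valued (does not attain the value +∞), then f is <-maximal in A and g is <-maximal in B. -/
open Filter Set

/-- Over a nonempty finite index set, the infimum defining `tconv` is a minimum. -/
theorem isLeast_tconv {V : Type} [Finite V] [Nonempty V] (f g : V → V → WithTop ℤ) (u w : V) :
    IsLeast (Set.range fun v => f u v + g v w) (tconv f g u w) := by
  obtain ⟨v, hv⟩ := Finite.exists_min fun v => f u v + g v w
  have h : IsLeast (Set.range fun v => f u v + g v w) (f u v + g v w) :=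
    ⟨⟨v, rfl⟩, Set.forall_mem_range.2 hv⟩
  have heq : tconv f g u w = f u v + g v w :=
    (WithTop.isGLB_sInf' ⟨_, h.2⟩).unique h.isGLB
  rwa [heq]

/-- If every summand for `(f', g')` that is not `⊤` strictly exceeds the matching summand for
`(f, g)`, then `tconv f' g'` strictly dominates `tconv f g`, provided the latter is finite. -/
theorem strictDom_tconv {V : Type} [Finite V] {f g f' g' : V → V → WithTop ℤ}
    (hfin : ∀ u w, tconv f g u w ≠ ⊤)
    (h : ∀ u v w, f' u v + g' v w ≠ ⊤ → f u v + g v w < f' u v + g' v w) :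
    StrictDom (tconv f g) (tconv f' g') := by
  intro u w
  have : Nonempty V := ⟨u⟩
  obtain ⟨v, hv⟩ := (isLeast_tconv f' g' u w).1
  rw [← hv]
  by_cases htop : f' u v + g' v w = ⊤
  · exact (lt_top_iff_ne_top.2 (hfin u w)).trans_eq htop.symm
  · exact ((isLeast_tconv f g u w).2 ⟨v, rfl⟩).trans_lt (h u v w htop)

/-- If `f * g` is `<`-maximal in `A * B` and `ℤ`-valued, then `f` is `<`-maximal in `A`
and `g` is `<`-maximal in `B`. -/
theorem maximal_factorization {E : Type} [Fintype E]
    (A B : Set (E → E → WithTop ℤ)) (hA : A.Finite) (hB : B.Finite)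
    (f g : E → E → WithTop ℤ) (hf : f ∈ A) (hg : g ∈ B)
    (hmax : tconv f g ∈ maxElems StrictDom (Set.image2 tconv A B))
    (hfin : ∀ u w : E, tconv f g u w ≠ ⊤) :
    f ∈ maxElems StrictDom A ∧ g ∈ maxElems StrictDom B := by
  refine ⟨⟨hf, ?_⟩, ⟨hg, ?_⟩⟩
  · rintro ⟨f', hf', hlt⟩
    refine hmax.2 ⟨tconv f' g, ⟨f', hf', g, hg, rfl⟩, strictDom_tconv hfin fun u v w h => ?_⟩
    exact WithTop.add_lt_add_right (WithTop.add_ne_top.1 h).2 (hlt u v)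
  · rintro ⟨g', hg', hlt⟩
    refine hmax.2 ⟨tconv f g', ⟨f, hf, g', hg', rfl⟩, strictDom_tconv hfin fun u v w h => ?_⟩
    exact WithTop.add_lt_add_left (WithTop.add_ne_top.1 h).1 (hlt v w)
end

section
/- Let E be a nonempty finite set, let f_1, f_2, f_3 ∈ ℤ^{E × E}, and let f = f_1 * f_2 * f_3. Then Δf ≤ 2‖f_1‖ + 2‖f_3‖. -/
open Filter Set

/-- `max f` over all pairs of indices. -/
noncomputable def fmax {E : Type} (f : E → E → ℤ) : ℤ :=
  sSup (Set.range fun p : E × E => f p.1 p.2)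

/-- `min f` over all pairs of indices. -/
noncomputable def fmin {E : Type} (f : E → E → ℤ) : ℤ :=
  sInf (Set.range fun p : E × E => f p.1 p.2)

/-- `‖f‖ = max |f|` over all pairs of indices. -/
noncomputable def fnorm {E : Type} (f : E → E → ℤ) : ℤ :=
  sSup (Set.range fun p : E × E => |f p.1 p.2|)

theorem tconvZ_le {V : Type} [Finite V] (f g : V → V → ℤ) (u v w : V) :
    tconvZ f g u w ≤ f u v + g v w :=
  csInf_le (Set.finite_range _).bddBelow ⟨v, rfl⟩

theorem exists_tconvZ_eq {V : Type} [Finite V] [Nonempty V] (f g : V → V → ℤ) (u w : V) :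
    ∃ v, tconvZ f g u w = f u v + g v w := by
  obtain ⟨v, hv⟩ := (Set.range_nonempty fun v => f u v + g v w).csInf_mem
    (Set.finite_range _)
  exact ⟨v, hv.symm⟩

theorem abs_le_fnorm {E : Type} [Finite E] (f : E → E → ℤ) (u v : E) : |f u v| ≤ fnorm f :=
  le_csSup (Set.finite_range _).bddAbove ⟨(u, v), rfl⟩

theorem exists_fmax_eq {E : Type} [Finite E] [Nonempty E] (f : E → E → ℤ) :
    ∃ u v, fmax f = f u v := by
  obtain ⟨p, hp⟩ := (Set.range_nonempty fun p : E × E => f p.1 p.2).csSup_mem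
    (Set.finite_range _)
  exact ⟨p.1, p.2, hp.symm⟩

theorem exists_fmin_eq {E : Type} [Finite E] [Nonempty E] (f : E → E → ℤ) :
    ∃ u v, fmin f = f u v := by
  obtain ⟨p, hp⟩ := (Set.range_nonempty fun p : E × E => f p.1 p.2).csInf_mem
    (Set.finite_range _)
  exact ⟨p.1, p.2, hp.symm⟩

/-- For `f = f₁ * f₂ * f₃`, one has `Δf ≤ 2‖f₁‖ + 2‖f₃‖`. -/
theorem three_product_delta {E : Type} [Fintype E] [Nonempty E]
    (f₁ f₂ f₃ : E → E → ℤ) (f : E → E → ℤ) (hf : f = tconvZ (tconvZ f₁ f₂) f₃) :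
    fmax f - fmin f ≤ 2 * fnorm f₁ + 2 * fnorm f₃ := by
  subst hf
  obtain ⟨u', w', hmax⟩ := exists_fmax_eq (tconvZ (tconvZ f₁ f₂) f₃)
  obtain ⟨u, w, hmin⟩ := exists_fmin_eq (tconvZ (tconvZ f₁ f₂) f₃)
  obtain ⟨y, hy⟩ := exists_tconvZ_eq (tconvZ f₁ f₂) f₃ u w
  obtain ⟨x, hx⟩ := exists_tconvZ_eq f₁ f₂ u y
  have hy' := tconvZ_le (tconvZ f₁ f₂) f₃ u' y w'
  have hx' := tconvZ_le f₁ f₂ u' x y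
  have h₁ := abs_le.mp (abs_le_fnorm f₁ u x)
  have h₁' := abs_le.mp (abs_le_fnorm f₁ u' x)
  have h₃ := abs_le.mp (abs_le_fnorm f₃ y w)
  have h₃' := abs_le.mp (abs_le_fnorm f₃ y w')
  linarith [h₁.1, h₁'.2, h₃.1, h₃'.2]
end

section
/- Let G, H be graphs and P : E_G × E_H → ℤ a payoff function. For any m, n ∈ ℕ, p ∈ W_n(H), and q ∈ W_m(H) such that the concatenation p*q is defined, if p*q ∈ W†_{n+m}(H) and M(p*q) is ℤ-valued, then p ∈ W†_n(H) and q ∈ W†_m(H). -/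
open Filter Set

theorem DirGraph.append_mem_walksFT {V E : Type} {G : DirGraph V E} {n m : ℕ} {a b c : V}
    {r s : List E} (hr : r ∈ G.walksFT n a b) (hs : s ∈ G.walksFT m b c) :
    r ++ s ∈ G.walksFT (n + m) a c := by
  obtain ⟨hrl, hrw, hr0, hra, hrb⟩ := hr
  obtain ⟨hsl, hsw, hs0, hsb, hsc⟩ := hs
  refine ⟨by simp [hrl, hsl], ?_, by simp [hr0], ?_, ?_⟩
  · refine List.isChain_append.2 ⟨hrw, hsw, ?_⟩
    intro x hx y hy
    rw [List.getLast?_eq_some_getLast hr0, Option.mem_some_iff] at hx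
    rw [List.head?_eq_some_head hs0, Option.mem_some_iff] at hy
    rw [← hx, ← hy, hrb, hsb]
  · rw [List.head_append_of_ne_nil hr0, hra]
  · rw [List.getLast_append_of_right_ne_nil _ _ hs0, hsc]

theorem DirGraph.exists_append_of_mem_walksFT_add {V E : Type} {G : DirGraph V E} {n m : ℕ}
    {a c : V} {r : List E} (hn : n ≠ 0) (hm : m ≠ 0) (hr : r ∈ G.walksFT (n + m) a c) :
    ∃ b, ∃ s ∈ G.walksFT n a b, ∃ t ∈ G.walksFT m b c, r = s ++ t := by
  obtain ⟨hl, hw, h0, ha, hc⟩ := hr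
  obtain ⟨s, t, rfl, hs⟩ : ∃ s t, r = s ++ t ∧ s.length = n :=
    ⟨r.take n, r.drop n, (List.take_append_drop n r).symm, by simp [hl]⟩
  have ht : t.length = m := by simpa [hs] using hl
  have hs0 : s ≠ [] := by rintro rfl; exact hn hs.symm
  have ht0 : t ≠ [] := by rintro rfl; exact hm ht.symm
  obtain ⟨hsw, htw, hst⟩ := List.isChain_append.1 hw
  refine ⟨G.tgt (s.getLast hs0), s, ⟨hs, hsw, hs0, ?_, rfl⟩, t, ⟨ht, htw, ht0, ?_, ?_⟩, rfl⟩
  · rwa [List.head_append_of_ne_nil hs0] at ha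
  · exact (hst _ (List.getLast?_eq_some_getLast hs0) _ (List.head?_eq_some_head ht0)).symm
  · rwa [List.getLast_append_of_right_ne_nil _ _ ht0] at hc

theorem DirGraph.finite_walksFT {V E : Type} [Finite E] (G : DirGraph V E) (n : ℕ) (a b : V) :
    (G.walksFT n a b).Finite :=
  (List.finite_length_eq E n).subset fun _ h => h.1

/-- The endpoints of a walk are determined by its edges. -/
theorem DirGraph.endpoints_eq_of_mem_walksFT {V E : Type} {G : DirGraph V E} {n m : ℕ}
    {a b c d : V} {r : List E} (h : r ∈ G.walksFT n a b) (h' : r ∈ G.walksFT m c d) :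
    a = c ∧ b = d := by
  obtain ⟨-, -, -, rfl, rfl⟩ := h
  obtain ⟨-, -, -, rfl, rfl⟩ := h'
  exact ⟨rfl, rfl⟩

theorem DirGraph.length_ne_zero_of_mem_walksFT {V E : Type} {G : DirGraph V E} {n : ℕ} {a b : V}
    {r : List E} (h : r ∈ G.walksFT n a b) : n ≠ 0 := by
  obtain ⟨rfl, -, h0, -⟩ := h
  simpa using h0

theorem payoffSum_append {EG EH : Type} (P : EG → EH → ℤ) {r s : List EG} {p q : List EH}
    (h : r.length = p.length) :
    payoffSum P (r ++ s) (p ++ q) = payoffSum P r p + payoffSum P s q := by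
  simp [payoffSum, List.zipWith_append h]

section Mfun

variable {VG EG EH : Type} [Finite EG] {G : DirGraph VG EG} {P : EG → EH → ℤ}

theorem Mfun_le_payoffSum {p : List EH} {r : List EG} {a b : VG}
    (hr : r ∈ G.walksFT p.length a b) : Mfun G P p a b ≤ payoffSum P r p :=
  csInf_le ((G.finite_walksFT _ _ _).image _).bddBelow (mem_image_of_mem _ hr)

theorem exists_payoffSum_eq_Mfun {p : List EH} {a b : VG} (h : Mfun G P p a b ≠ ⊤) :
    ∃ r ∈ G.walksFT p.length a b, (payoffSum P r p : WithTop ℤ) = Mfun G P p a b := by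
  have hne : (G.walksFT p.length a b).Nonempty := by
    by_contra h0
    rw [Set.not_nonempty_iff_eq_empty] at h0
    exact h (by simp [Mfun, h0])
  exact (hne.image _).csInf_mem ((G.finite_walksFT _ _ _).image _)

theorem exists_payoffSum_lt_of_Mfun_lt {p p' : List EH} {a b : VG}
    (h : Mfun G P p a b < Mfun G P p' a b) {r : List EG} (hr : r ∈ G.walksFT p'.length a b) :
    ∃ s ∈ G.walksFT p.length a b, payoffSum P s p < payoffSum P r p' := by
  obtain ⟨s, hs, hsM⟩ := exists_payoffSum_eq_Mfun h.ne_top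
  refine ⟨s, hs, ?_⟩
  have := h.trans_le (Mfun_le_payoffSum hr)
  rw [← hsM] at this
  exact_mod_cast this

theorem strictDom_Mfun_of_forall_exists {p p' : List EH} (hfin : ∀ a b, Mfun G P p a b ≠ ⊤)
    (h : ∀ a b, ∀ r ∈ G.walksFT p'.length a b,
      ∃ s ∈ G.walksFT p.length a b, payoffSum P s p < payoffSum P r p') :
    StrictDom (Mfun G P p) (Mfun G P p') := by
  intro a b
  by_cases htop : Mfun G P p' a b = ⊤
  · rw [htop]
    exact lt_top_iff_ne_top.2 (hfin a b)
  · obtain ⟨r, hr, hrM⟩ := exists_payoffSum_eq_Mfun htop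
    obtain ⟨s, hs, hlt⟩ := h a b r hr
    rw [← hrM]
    exact (Mfun_le_payoffSum hs).trans_lt (by exact_mod_cast hlt)

theorem strictDom_Mfun_append_right {p p' q : List EH} (hfin : ∀ a b, Mfun G P (p ++ q) a b ≠ ⊤)
    (hp : p'.length ≠ 0) (hq : q.length ≠ 0) (h : StrictDom (Mfun G P p) (Mfun G P p')) :
    StrictDom (Mfun G P (p ++ q)) (Mfun G P (p' ++ q)) := by
  refine strictDom_Mfun_of_forall_exists hfin fun a b r hr => ?_
  rw [List.length_append] at hr
  obtain ⟨c, r₁, h₁, r₂, h₂, rfl⟩ := DirGraph.exists_append_of_mem_walksFT_add hp hq hr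
  obtain ⟨s, hs, hlt⟩ := exists_payoffSum_lt_of_Mfun_lt (h a c) h₁
  refine ⟨s ++ r₂, by simpa using DirGraph.append_mem_walksFT hs h₂, ?_⟩
  rw [payoffSum_append P hs.1, payoffSum_append P h₁.1]
  gcongr

theorem strictDom_Mfun_append_left {p q q' : List EH} (hfin : ∀ a b, Mfun G P (p ++ q) a b ≠ ⊤)
    (hp : p.length ≠ 0) (hq : q'.length ≠ 0) (h : StrictDom (Mfun G P q) (Mfun G P q')) :
    StrictDom (Mfun G P (p ++ q)) (Mfun G P (p ++ q')) := by
  refine strictDom_Mfun_of_forall_exists hfin fun a b r hr => ?_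
  rw [List.length_append] at hr
  obtain ⟨c, r₁, h₁, r₂, h₂, rfl⟩ := DirGraph.exists_append_of_mem_walksFT_add hp hq hr
  obtain ⟨s, hs, hlt⟩ := exists_payoffSum_lt_of_Mfun_lt (h c b) h₂
  refine ⟨r₁ ++ s, by simpa using DirGraph.append_mem_walksFT h₁ hs, ?_⟩
  rw [payoffSum_append P h₁.1, payoffSum_append P h₁.1]
  gcongr

end Mfun

/-- A segment of a non-improvable walk is non-improvable. -/
theorem non_improvable_subwalk {VG EG VH EH : Type} [Fintype VG] [Fintype EG]
    [Fintype VH] [Fintype EH] (G : DirGraph VG EG) (H : DirGraph VH EH)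
    (P : EG → EH → ℤ) (m n : ℕ) (u v w : VH) (p q : List EH)
    (hp : p ∈ H.walksFT n u v) (hq : q ∈ H.walksFT m v w)
    (hdag : p ++ q ∈ walksDagger G H P)
    (hfin : ∀ a b : VG, Mfun G P (p ++ q) a b ≠ ⊤) :
    p ∈ walksDagger G H P ∧ q ∈ walksDagger G H P := by
  have hn := DirGraph.length_ne_zero_of_mem_walksFT hp
  have hm := DirGraph.length_ne_zero_of_mem_walksFT hq
  obtain rfl := hp.1
  obtain rfl := hq.1
  obtain ⟨u', w', hpq, -, hmax⟩ := hdag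
  obtain ⟨rfl, rfl⟩ :=
    DirGraph.endpoints_eq_of_mem_walksFT hpq (DirGraph.append_mem_walksFT hp hq)
  refine ⟨⟨u', v, hp, mem_image_of_mem _ hp, ?_⟩, ⟨v, w', hq, mem_image_of_mem _ hq, ?_⟩⟩
  · rintro ⟨_, ⟨p', hp', rfl⟩, hlt⟩
    refine hmax ⟨_, mem_image_of_mem _ ?_,
      strictDom_Mfun_append_right hfin (hp'.1.trans_ne hn) hm hlt⟩
    simpa using DirGraph.append_mem_walksFT hp' hq
  · rintro ⟨_, ⟨q', hq', rfl⟩, hlt⟩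
    refine hmax ⟨_, mem_image_of_mem _ ?_,
      strictDom_Mfun_append_left hfin hn (hq'.1.trans_ne hm) hlt⟩
    simpa using DirGraph.append_mem_walksFT hp hq'
end
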